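/- Let S be an m×p binary matrix and Δ a p×m binary matrix, and define the p×p binary matrix R*_S by (R*_S)_{jk} = 0 iff there exists an index i with S_{ij} = 1 and S_{ik} = 0 (the output of Algorithm 1 with T = S). Then the following are equivalent (all products and powers Boolean): (i) S·Δ·S ≤ S (the quadratic invariance condition); (ii) I_p + Δ·S ≤ R*_S, i.e. R*_S ≥ I_p + ΔS. (Theorem 3.) -/

import Mathlib

/-- Boolean (logical) matrix product. -/
def bmul {m p q : ℕ} (A : Matrix (Fin m) (Fin p) Bool) (B : Matrix (Fin p) (Fin q) Bool) :
    Matrix (Fin m) (Fin q) Bool :=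
  fun i k => decide (∃ j, A i j = true ∧ B j k = true)

/-- Identity binary matrix. -/
def bId (p : ℕ) : Matrix (Fin p) (Fin p) Bool := fun i j => decide (i = j)

/-- Boolean (entrywise OR) sum of binary matrices. -/
def badd {m p : ℕ} (A B : Matrix (Fin m) (Fin p) Bool) : Matrix (Fin m) (Fin p) Bool :=
  fun i j => A i j || B i j

/-- k-fold Boolean power (bpow R 0 = identity). -/
def bpow {p : ℕ} (R : Matrix (Fin p) (Fin p) Bool) : ℕ → Matrix (Fin p) (Fin p) Bool
  | 0 => bId p
  | k + 1 => bmul (bpow R k) R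

/-- Entrywise order on binary matrices. -/
def bLE {m p : ℕ} (A B : Matrix (Fin m) (Fin p) Bool) : Prop :=
  ∀ i j, A i j = true → B i j = true

/-- A square binary matrix is reflexive if all diagonal entries are 1. -/
def BRefl {p : ℕ} (R : Matrix (Fin p) (Fin p) Bool) : Prop := ∀ i, R i i = true

/-- Y ∈ Sparse(T): Y vanishes wherever the pattern T is zero. -/
def Sparse {K : Type*} [Field K] {m p : ℕ} (T : Matrix (Fin m) (Fin p) Bool)
    (Y : Matrix (Fin m) (Fin p) K) : Prop :=
  ∀ i j, T i j = false → Y i j = 0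

/-- Output of Algorithm 1: (R*_T)_{jk} = 0 iff ∃ i, T_{ij} = 1 and T_{ik} = 0. -/
def Rstar {m p : ℕ} (T : Matrix (Fin m) (Fin p) Bool) : Matrix (Fin p) (Fin p) Bool :=
  fun j k => !decide (∃ i, T i j = true ∧ T i k = false)

theorem bmul_eq_true_iff {m p q : ℕ} (A : Matrix (Fin m) (Fin p) Bool)
    (B : Matrix (Fin p) (Fin q) Bool) (i : Fin m) (k : Fin q) :
    bmul A B i k = true ↔ ∃ j, A i j = true ∧ B j k = true := by
  simp [bmul]

theorem badd_eq_true_iff {m p : ℕ} (A B : Matrix (Fin m) (Fin p) Bool) (i : Fin m) (j : Fin p) :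
    badd A B i j = true ↔ A i j = true ∨ B i j = true := by
  simp [badd]

theorem bId_eq_true_iff {p : ℕ} (i j : Fin p) : bId p i j = true ↔ i = j := by
  simp [bId]

theorem Rstar_eq_true_iff {m p : ℕ} (T : Matrix (Fin m) (Fin p) Bool) (j k : Fin p) :
    Rstar T j k = true ↔ ∀ i, T i j = true → T i k = true := by
  simp [Rstar]

/-- Theorem 3, QI is equivalent to R*_S ≥ I_p + ΔS. -/
theorem QI_iff_Rstar_ge {m p : ℕ}
    (S : Matrix (Fin m) (Fin p) Bool) (Δ : Matrix (Fin p) (Fin m) Bool) :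
    bLE (bmul (bmul S Δ) S) S ↔ bLE (badd (bId p) (bmul Δ S)) (Rstar S) := by
  simp only [bLE, bmul_eq_true_iff, badd_eq_true_iff, bId_eq_true_iff, Rstar_eq_true_iff]
  constructor
  · rintro h l k (rfl | ⟨j, hlj, hjk⟩) i hil
    · exact hil
    · exact h i k ⟨j, ⟨l, hil, hlj⟩, hjk⟩
  · rintro h i k ⟨j, ⟨l, hil, hlj⟩, hjk⟩
    exact h l k (Or.inr ⟨j, hlj, hjk⟩) i hil
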